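/- The quadratic polynomial Q_2 = x_1x_8 + x_2x_7 + x_3x_6 + x_4x_5 is, up to equality of polynomial functions, the unique nonzero homogeneous-degree-≤2 squarefree polynomial on GF(2)^8 invariant under the stabilizer G_S of the Segre variety S_{1,1,1}(2) (in the given Segre coordinates). -/

import Mathlib

open Pointwise

/-- Index set for coordinates of `V_2 ⊗ V_2 ⊗ V_2` over `GF(2)`. -/
abbrev ι3 := Fin 2 × Fin 2 × Fin 2

/-- `V_8 = V(2,2) ⊗ V(2,2) ⊗ V(2,2)`, realized in coordinates as `GF(2)^(2×2×2)`. -/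
abbrev V8 := ι3 → ZMod 2

/-- The Segre variety `S_{1,1,1}(2)`: the nonzero decomposable tensors `u ⊗ v ⊗ w`. -/
def Segre : Set V8 :=
  {x | x ≠ 0 ∧ ∃ u v w : Fin 2 → ZMod 2, x = fun p => u p.1 * v p.2.1 * w p.2.2}

/-- The stabilizer of the Segre variety in `GL(8,2)`. -/
def SegreStab : Subgroup (V8 ≃ₗ[ZMod 2] V8) :=
  MulAction.stabilizer (V8 ≃ₗ[ZMod 2] V8) Segre

/-- Evaluation of a squarefree (multilinear) polynomial given by its coefficients. -/
def mEval (c : Finset ι3 → ZMod 2) (x : V8) : ZMod 2 :=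
  ∑ s : Finset ι3, c s * ∏ i ∈ s, x i

/-- The quadratic form `Q₂ = x₁x₈ + x₂x₇ + x₃x₆ + x₄x₅` in the Segre coordinates. -/
def Q2 (x : V8) : ZMod 2 :=
  x (0, 0, 0) * x (1, 1, 1) + x (1, 0, 0) * x (0, 1, 1) +
    x (1, 1, 0) * x (0, 0, 1) + x (0, 1, 0) * x (1, 0, 1)

def ee (i : ι3) : V8 := fun j => if j = i then 1 else 0

def IsQuad (F : V8 → ZMod 2) : Prop :=
  F 0 = 0 ∧ ∀ x y z, F (x + y + z) + F (x + y) + F (x + z) + F (y + z) + F x + F y + F z = 0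

theorem z2 (a : ZMod 2) : a + a = 0 := by revert a; decide

theorem v2 (x : V8) : x + x = 0 := by funext i; exact z2 _

theorem IsQuad.zero {F : V8 → ZMod 2} (h : IsQuad F) (h1 : ∀ i, F (ee i) = 0)
    (h2 : ∀ i j, F (ee i + ee j) = 0) (x : V8) : F x = 0 := by
  have key : ∀ s : Finset ι3, F (∑ i ∈ s, ee i) = 0 ∧ ∀ j, F ((∑ i ∈ s, ee i) + ee j) = 0 := by
    intro s
    induction s using Finset.induction_on with
    | empty => simp [h.1, h1]
    | insert i s hi ih =>
      rw [Finset.sum_insert hi, add_comm (ee i)]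
      refine ⟨ih.2 i, fun j => ?_⟩
      have := h.2 (∑ i ∈ s, ee i) (ee i) (ee j)
      rw [ih.1, ih.2, ih.2, h1, h1, h2] at this
      simpa using this
  have hx : x = ∑ i ∈ Finset.univ.filter (fun i => x i = 1), ee i := by
    funext j
    rw [Finset.sum_apply]
    simp only [ee, Finset.sum_ite_eq, Finset.mem_filter, Finset.mem_univ, true_and]
    generalize x j = a
    revert a; decide
  rw [hx]; exact (key _).1

theorem IsQuad.add {F G : V8 → ZMod 2} (h : IsQuad F) (h' : IsQuad G) :
    IsQuad (fun x => F x + G x) := by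
  refine ⟨by simp [h.1, h'.1], fun x y z => ?_⟩
  linear_combination h.2 x y z + h'.2 x y z

theorem IsQuad.smul {F : V8 → ZMod 2} (h : IsQuad F) (a : ZMod 2) :
    IsQuad (fun x => a * F x) := by
  refine ⟨by simp [h.1], fun x y z => ?_⟩
  linear_combination a * h.2 x y z

theorem IsQuad.comp {F : V8 → ZMod 2} (h : IsQuad F) (A : V8 ≃ₗ[ZMod 2] V8) :
    IsQuad (fun x => F (A x)) := by
  refine ⟨by simp [h.1], fun x y z => ?_⟩
  simp only [map_add]
  exact h.2 _ _ _

theorem two0 : (2 : ZMod 2) = 0 := rfl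

theorem Q2_quad : IsQuad Q2 := by
  refine ⟨by simp [Q2], fun x y z => ?_⟩
  simp only [Q2, Pi.add_apply]
  ring_nf
  simp [show (4 : ZMod 2) = 0 from rfl, two0]

theorem mEval_quad (c : Finset ι3 → ZMod 2) (h0 : c ∅ = 0)
    (h : ∀ s, c s ≠ 0 → s.card ≤ 2) : IsQuad (mEval c) := by
  constructor
  · unfold mEval
    refine Finset.sum_eq_zero fun s _ => ?_
    rcases s.eq_empty_or_nonempty with rfl | ⟨i, hi⟩
    · simp [h0]
    · rw [Finset.prod_eq_zero hi (by simp), mul_zero]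
  · intro x y z
    simp only [mEval, ← Finset.sum_add_distrib]
    refine Finset.sum_eq_zero fun s _ => ?_
    by_cases hs : c s = 0
    · simp [hs]
    have h3 := h s hs
    interval_cases hc : s.card
    · rw [Finset.card_eq_zero] at hc
      simp [hc, h0]
    · obtain ⟨i, rfl⟩ := Finset.card_eq_one.1 hc
      simp only [Finset.prod_singleton, Pi.add_apply]
      linear_combination (2 * c {i} * (x i + y i + z i)) * two0
    · obtain ⟨i, j, hij, rfl⟩ := Finset.card_eq_two.1 hc
      simp only [Finset.prod_pair hij, Pi.add_apply]
      ring_nf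
      simp [show (4 : ZMod 2) = 0 from rfl, two0]

/-! Invariance of `Q2` -/

def dec (u v w : Fin 2 → ZMod 2) : V8 := fun p => u p.1 * v p.2.1 * w p.2.2

def br (u v : Fin 2 → ZMod 2) : ZMod 2 := u 0 * v 1 + u 1 * v 0

theorem br_self (u : Fin 2 → ZMod 2) : br u u = 0 := by
  unfold br; linear_combination (u 0 * u 1) * two0

theorem Q2_dec (u v w u' v' w' : Fin 2 → ZMod 2) :
    Q2 (dec u v w + dec u' v' w') = br u u' * br v v' * br w w' := by
  simp only [Q2, dec, br, Pi.add_apply]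
  ring_nf
  simp [show (4 : ZMod 2) = 0 from rfl, two0]

theorem Q2_dec1 (u v w : Fin 2 → ZMod 2) : Q2 (dec u v w) = 0 := by
  simp only [Q2, dec]
  ring_nf
  simp [show (4 : ZMod 2) = 0 from rfl, two0]

def DD (x : V8) : Prop := ∃ u v w, x = dec u v w

theorem DD_iff (x : V8) : DD x ↔ (x = 0 ∨ x ∈ Segre) := by
  constructor
  · rintro ⟨u, v, w, h⟩
    by_cases hx : x = 0
    · exact Or.inl hx
    · exact Or.inr ⟨hx, u, v, w, h⟩
  · rintro (rfl | ⟨_, u, v, w, h⟩)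
    · exact ⟨0, 0, 0, by funext p; simp [dec]⟩
    · exact ⟨u, v, w, h⟩

theorem br_eq : ∀ u v : Fin 2 → ZMod 2, u ≠ 0 → v ≠ 0 → br u v = 0 → u = v := by decide

theorem ne_dec {u v w : Fin 2 → ZMod 2} (h : dec u v w ≠ 0) : u ≠ 0 ∧ v ≠ 0 ∧ w ≠ 0 := by
  refine ⟨?_, ?_, ?_⟩ <;> rintro rfl <;> exact h (by funext p; simp [dec])

theorem br1 {u v : Fin 2 → ZMod 2} (hu : u ≠ 0) (hv : v ≠ 0) (h : u ≠ v) : br u v = 1 := by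
  have := mt (br_eq u v hu hv) h
  generalize br u v = a at *
  revert a; decide

theorem sym_eq : ∀ v w v' w' : Fin 2 → ZMod 2, v ≠ 0 → w ≠ 0 → v' ≠ 0 → w' ≠ 0 →
    (∀ b b' d d', v b * w d * (v' b' * w' d') = v b' * w d' * (v' b * w' d)) →
    v = v' ∧ w = w' := by
  intro v w v' w' hv hw hv' hw' h
  have one : ∀ a : ZMod 2, a ≠ 0 → a = 1 := by decide
  obtain ⟨b, hb⟩ := Function.ne_iff.1 hv
  obtain ⟨d, hd⟩ := Function.ne_iff.1 hw
  obtain ⟨b', hb'⟩ := Function.ne_iff.1 hv'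
  obtain ⟨d', hd'⟩ := Function.ne_iff.1 hw'
  have t := h b b' d d'
  have nz : v' b ≠ 0 ∧ w' d ≠ 0 := by
    have h1 : v b * w d * (v' b' * w' d') ≠ 0 := mul_ne_zero (mul_ne_zero hb hd) (mul_ne_zero hb' hd')
    rw [t] at h1
    constructor <;> intro h2 <;> apply h1 <;> rw [h2] <;> ring
  have e1 := one _ hb
  have e2 := one _ hd
  have e3 := one _ nz.1
  have e4 := one _ nz.2
  constructor
  · funext i
    have := h b i d d
    simpa [e1, e2, e3, e4] using this.symm
  · funext i
    have := h b b d i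
    simpa [e1, e2, e3, e4] using this.symm

theorem adj {u v w u' v' w' : Fin 2 → ZMod 2} (hu : u ≠ 0) (hv : v ≠ 0) (hw : w ≠ 0)
    (hu' : u' ≠ 0) (hv' : v' ≠ 0) (hw' : w' ≠ 0) (h : DD (dec u v w + dec u' v' w')) :
    (v = v' ∧ w = w') ∨ (u = u' ∧ w = w') ∨ (u = u' ∧ v = v') := by
  obtain ⟨a, b, c, h⟩ := h
  have hx : ∀ i j k, u i * v j * w k + u' i * v' j * w' k = a i * b j * c k :=
    fun i j k => congrFun h (i, j, k)
  by_cases e1 : u = u'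
  · by_cases e2 : v = v'
    · exact Or.inr (Or.inr ⟨e1, e2⟩)
    · refine Or.inr (Or.inl ⟨e1, ?_⟩)
      refine (sym_eq u w u' w' hu hw hu' hw' fun i i' k k' => ?_).2
      have := br1 hv hv' e2
      unfold br at this
      have t1 := hx i 0 k
      have t2 := hx i' 1 k'
      have t3 := hx i 1 k
      have t4 := hx i' 0 k'
      grind [two0]
  · left
    refine sym_eq v w v' w' hv hw hv' hw' fun i i' k k' => ?_
    have := br1 hu hu' e1
    unfold br at this
    have t1 := hx 0 i k
    have t2 := hx 1 i' k'
    have t3 := hx 1 i k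
    have t4 := hx 0 i' k'
    grind [two0]

def RelS (p q : V8) : Prop := ∃ r ∈ Segre, DD (p + r) ∧ DD (r + q)

theorem rel_iff {p q : V8} (hp : p ∈ Segre) (hq : q ∈ Segre) : Q2 (p + q) = 0 ↔ RelS p q := by
  obtain ⟨p0, u, v, w, rfl⟩ := hp
  obtain ⟨q0, u', v', w', rfl⟩ := hq
  change dec u v w ≠ 0 at p0
  change dec u' v' w' ≠ 0 at q0
  change Q2 (dec u v w + dec u' v' w') = 0 ↔ RelS (dec u v w) (dec u' v' w')
  obtain ⟨hu, hv, hw⟩ := ne_dec p0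
  obtain ⟨hu', hv', hw'⟩ := ne_dec q0
  rw [Q2_dec]
  constructor
  · intro h
    have ne : ∀ {u v w : Fin 2 → ZMod 2}, u ≠ 0 → v ≠ 0 → w ≠ 0 → dec u v w ≠ 0 := by
      intro u v w hu hv hw h
      obtain ⟨i, hi⟩ := Function.ne_iff.1 hu
      obtain ⟨j, hj⟩ := Function.ne_iff.1 hv
      obtain ⟨k, hk⟩ := Function.ne_iff.1 hw
      exact mul_ne_zero (mul_ne_zero hi hj) hk (congrFun h (i, j, k))
    rcases mul_eq_zero.1 h with h | h
    · rcases mul_eq_zero.1 h with h | h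
      · have := br_eq _ _ hu hu' h
        subst this
        refine ⟨dec u v' w, ⟨ne hu hv' hw, u, v', w, rfl⟩, ⟨u, v + v', w, ?_⟩, ⟨u, v', w + w', ?_⟩⟩ <;>
          (funext p; simp only [dec, Pi.add_apply]; ring)
      · have := br_eq _ _ hv hv' h
        subst this
        refine ⟨dec u' v w, ⟨ne hu' hv hw, u', v, w, rfl⟩, ⟨u + u', v, w, ?_⟩, ⟨u', v, w + w', ?_⟩⟩ <;>
          (funext p; simp only [dec, Pi.add_apply]; ring)
    · have := br_eq _ _ hw hw' h
      subst this
      refine ⟨dec u' v w, ⟨ne hu' hv hw, u', v, w, rfl⟩, ⟨u + u', v, w, ?_⟩, ⟨u', v + v', w, ?_⟩⟩ <;>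
          (funext p; simp only [dec, Pi.add_apply]; ring)
  · rintro ⟨r, ⟨r0, a, b, c, rfl⟩, h1, h2⟩
    obtain ⟨ha, hb, hc⟩ := ne_dec r0
    rcases adj hu hv hw ha hb hc h1 with ⟨rfl, rfl⟩ | ⟨rfl, rfl⟩ | ⟨rfl, rfl⟩ <;>
    rcases adj ha hb hc hu' hv' hw' h2 with ⟨rfl, rfl⟩ | ⟨rfl, rfl⟩ | ⟨rfl, rfl⟩ <;>
    simp [br_self]

theorem ee_segre (i : ι3) : ee i ∈ Segre := by
  refine ⟨fun h => ?_, fun a => if a = i.1 then 1 else 0, fun a => if a = i.2.1 then 1 else 0,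
    fun a => if a = i.2.2 then 1 else 0, ?_⟩
  · have := congrFun h i
    simp [ee] at this
  · revert i; decide

theorem stab_iff {A : V8 ≃ₗ[ZMod 2] V8} (hA : A ∈ SegreStab) (x : V8) :
    A x ∈ Segre ↔ x ∈ Segre := by
  have h : A • Segre = Segre := hA
  conv_lhs => rw [← h]
  exact Set.smul_mem_smul_set_iff (a := A)

theorem part1 (A : V8 ≃ₗ[ZMod 2] V8) (hA : A ∈ SegreStab) (x : V8) : Q2 (A x) = Q2 x := by
  have hs := stab_iff hA
  have hD : ∀ x, DD (A x) ↔ DD x := fun x => by simp [DD_iff, hs]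
  have hR : ∀ p q, RelS (A p) (A q) ↔ RelS p q := by
    intro p q
    constructor
    · rintro ⟨r, hr, h1, h2⟩
      obtain ⟨r, rfl⟩ := A.surjective r
      rw [← map_add, hD] at h1 h2
      exact ⟨r, (hs r).1 hr, h1, h2⟩
    · rintro ⟨r, hr, h1, h2⟩
      refine ⟨A r, (hs r).2 hr, ?_, ?_⟩ <;> rw [← map_add, hD] <;> assumption
  have hz : ∀ x ∈ Segre, Q2 x = 0 := by
    rintro x ⟨_, u, v, w, rfl⟩
    exact Q2_dec1 u v w
  have ez : ∀ a b : ZMod 2, (a = 0 ↔ b = 0) → a + b = 0 := by decide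
  have := ((Q2_quad.comp A).add Q2_quad).zero
    (fun i => by simp [hz _ ((hs _).2 (ee_segre i)), hz _ (ee_segre i)])
    (fun i j => by
      apply ez
      rw [map_add, rel_iff ((hs _).2 (ee_segre i)) ((hs _).2 (ee_segre j)),
        rel_iff (ee_segre i) (ee_segre j), hR]) x
  have e2 : ∀ a b : ZMod 2, a + b = 0 → a = b := by decide
  exact e2 _ _ this

/-! Uniqueness -/

def co (k : Fin 3) (p : ι3) : Fin 2 := if k = 0 then p.1 else if k = 1 then p.2.1 else p.2.2

def fl (k : Fin 3) (p : ι3) : ι3 :=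
  if k = 0 then (p.1 + 1, p.2) else if k = 1 then (p.1, p.2.1 + 1, p.2.2)
  else (p.1, p.2.1, p.2.2 + 1)

def tf (k : Fin 3) (a : Fin 2) (x : V8) : V8 :=
  fun p => if co k p = a then x p else x p + x (fl k p)

theorem co_fl : ∀ k p, ∀ a, co k p ≠ a → co k (fl k p) = a := by decide

theorem tf_tf (k : Fin 3) (a : Fin 2) (x : V8) : tf k a (tf k a x) = x := by
  funext p
  unfold tf
  by_cases h : co k p = a
  · simp [h]
  · simp only [h, co_fl k p a h, if_true, if_false]
    linear_combination z2 (x (fl k p))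

def TT (k : Fin 3) (a : Fin 2) : V8 ≃ₗ[ZMod 2] V8 where
  toFun := tf k a
  invFun := tf k a
  left_inv := tf_tf k a
  right_inv := tf_tf k a
  map_add' x y := by
    funext p
    simp only [tf, Pi.add_apply]
    split_ifs <;> ring
  map_smul' r x := by
    funext p
    simp only [tf, Pi.smul_apply, smul_eq_mul, RingHom.id_apply]
    split_ifs <;> ring

theorem tf_segre (k : Fin 3) (a : Fin 2) (x : V8) (h : x ∈ Segre) : tf k a x ∈ Segre := by
  obtain ⟨h0, u, v, w, hx⟩ := h
  refine ⟨fun h => h0 ?_, ?_⟩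
  · rw [← tf_tf k a x, h]; funext p; simp [tf]
  subst hx
  let g (u : Fin 2 → ZMod 2) : Fin 2 → ZMod 2 := fun p => if p = a then u p else u p + u (p + 1)
  fin_cases k
  · refine ⟨g u, v, w, ?_⟩
    funext p
    simp [tf, co, fl, g]
    split_ifs <;> ring
  · refine ⟨u, g v, w, ?_⟩
    funext p
    simp [tf, co, fl, g]
    split_ifs <;> ring
  · refine ⟨u, v, g w, ?_⟩
    funext p
    simp [tf, co, fl, g]
    split_ifs <;> ring

theorem TT_stab (k : Fin 3) (a : Fin 2) : TT k a ∈ SegreStab := by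
  change TT k a • Segre = Segre
  ext x
  constructor
  · rintro ⟨y, hy, rfl⟩
    exact tf_segre k a y hy
  · intro hx
    exact ⟨tf k a x, tf_segre k a x hx, tf_tf k a x⟩

theorem T_same (k : Fin 3) (i : ι3) : tf k (co k i) (ee i) = ee i + ee (fl k i) := by
  revert k i; decide

theorem T_same' (k : Fin 3) (i j : ι3) (h : co k j = co k i) :
    tf k (co k i) (ee j) = ee j + ee (fl k j) := by
  rw [← h, T_same]

theorem T_diff : ∀ (k : Fin 3) (i j : ι3) (_ : co k j ≠ co k i),
    tf k (co k i) (ee j) = ee j := by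
  decide

theorem mEval_zero (c : Finset ι3 → ZMod 2) (h : ∀ x, mEval c x = 0) : c = 0 := by
  funext s
  induction s using Finset.strongInduction with
  | H s ih =>
    have := h (fun i => if i ∈ s then 1 else 0)
    unfold mEval at this
    rw [Finset.sum_eq_single s] at this
    · rw [Finset.prod_eq_one, mul_one] at this
      · exact this
      · intro i hi; simp [hi]
    · intro t _ hts
      by_cases hsub : t ⊆ s
      · rw [ih t (Finset.ssubset_iff_subset_ne.2 ⟨hsub, hts⟩)]; simp
      · obtain ⟨i, hi, his⟩ := Finset.not_subset.1 hsub
        rw [Finset.prod_eq_zero hi (by simp [his]), mul_zero]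
    · simp

theorem uniq {F : V8 → ZMod 2} (h : IsQuad F) (hT : ∀ k a x, F (tf k a x) = F x) :
    ∃ l : ZMod 2, ∀ x, F x = l * Q2 x := by
  have hadd : ∀ k a x y, tf k a (x + y) = tf k a x + tf k a y := fun k a => (TT k a).map_add
  have flfl : ∀ k i, fl k (fl k i) = i := by decide
  have a1 : ∀ k i, F (ee i + ee (fl k i)) = F (ee i) := by
    intro k i
    rw [← T_same, hT]
  have a2 : ∀ k i, F (ee (fl k i)) = F (ee i) := by
    intro k i
    rw [← a1 k i, ← a1 k (fl k i), flfl, add_comm]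
  have cfl : ∀ k i, co k (fl k i) ≠ co k i := by decide
  have cfl2 : ∀ k m i, k ≠ m → co k (fl k (fl m i)) ≠ co k i := by decide
  have cfl3 : ∀ k m i, k ≠ m → co k (fl m i) = co k i := by decide
  have flc : ∀ k m i, fl k (fl m i) = fl m (fl k i) := by decide
  have l0 : ∀ i, F (ee i) = 0 := by
    intro i
    have e := hT 0 (co 0 i) (ee i + ee (fl 0 (fl 1 i)))
    rw [hadd, T_same, T_diff _ _ _ (cfl2 0 1 i (by decide))] at e
    have t := h.2 (ee i) (ee (fl 0 i)) (ee (fl 0 (fl 1 i)))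
    have b := a1 1 (fl 0 i)
    rw [flc 1 0 i] at b
    rw [e, b, a1, a2, a2, a2] at t
    have : ∀ a b : ZMod 2, a + b + a + b + b + b + b = 0 → b = 0 := by decide
    grind
  have d1 : ∀ k i, F (ee i + ee (fl k i)) = 0 := fun k i => by rw [a1, l0]
  have an : ∀ i, fl 0 (fl 1 (fl 2 i)) = (i.1 + 1, i.2.1 + 1, i.2.2 + 1) := by decide
  have d2 : ∀ k m n i, k ≠ m → k ≠ n → m ≠ n → F (ee i + ee (fl m (fl n i))) = 0 := by
    intro k m n i hkm hkn hmn
    have hz : co k (fl m (fl n i)) ≠ co k (fl k i) := by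
      rw [cfl3 k m _ hkm, cfl3 k n _ hkn]; exact (cfl k i).symm
    have e := hT k (co k (fl k i)) (ee (fl k i) + ee (fl m (fl n i)))
    rw [hadd, T_same, T_diff _ _ _ hz, flfl] at e
    have t := h.2 (ee (fl k i)) (ee i) (ee (fl m (fl n i)))
    have b := d1 k i
    rw [add_comm] at b
    rw [e, b, l0, l0, l0] at t
    have := z2 (F (ee (fl k i) + ee (fl m (fl n i))))
    linear_combination t - this
  have d3 : ∀ k m n i, k ≠ m → k ≠ n → m ≠ n →
      F (ee i + ee (fl k (fl m (fl n i)))) = F (ee (fl k i) + ee (fl m (fl n i))) := by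
    intro k m n i hkm hkn hmn
    have hz : co k (fl m (fl n i)) = co k i := by
      rw [cfl3 k m _ hkm, cfl3 k n _ hkn]
    have e := hT k (co k i) (ee i + ee (fl m (fl n i)))
    rw [hadd, T_same, T_same' _ _ _ hz, d2 k m n i hkm hkn hmn] at e
    have b := d2 k m n (fl k i) hkm hkn hmn
    rw [flc n k, flc m k] at b
    have b1 := d2 k m n i hkm hkn hmn
    have b2 := d1 k (fl m (fl n i))
    have b3 := d1 k i
    have l1 := l0 i
    have l2 := l0 (fl k i)
    have l3 := l0 (fl m (fl n i))
    have l4 := l0 (fl k (fl m (fl n i)))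
    generalize ee i = x at *
    generalize ee (fl k i) = x' at *
    generalize ee (fl k (fl m (fl n i))) = w' at *
    generalize ee (fl m (fl n i)) = w at *
    have t1 := h.2 x x' (w + w')
    have t2 := h.2 x w w'
    have t3 := h.2 x' w w'
    rw [← add_assoc x, ← add_assoc x'] at t1
    have ez : ∀ a b : ZMod 2, a + b = 0 → a = b := by decide
    apply ez
    simp only [e, b, b1, b2, b3, l1, l2, l3, l4, add_zero, zero_add] at t1 t2 t3
    grind [two0]
  refine ⟨F (ee (0,0,0) + ee (1,1,1)), fun x => ?_⟩
  set l := F (ee (0,0,0) + ee (1,1,1)) with hl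
  have dn : ∀ i, F (ee i + ee (fl 0 (fl 1 (fl 2 i)))) = l := by
    have s0 : ∀ i, F (ee (fl 0 i) + ee (fl 0 (fl 1 (fl 2 (fl 0 i))))) =
        F (ee i + ee (fl 0 (fl 1 (fl 2 i)))) := by
      intro i
      rw [d3 0 1 2 i (by decide) (by decide) (by decide), flc 2 0, flc 1 0, flfl]
    have s1 : ∀ i, F (ee (fl 1 i) + ee (fl 0 (fl 1 (fl 2 (fl 1 i))))) =
        F (ee i + ee (fl 0 (fl 1 (fl 2 i)))) := by
      intro i
      rw [flc 0 1 (fl 2 i), d3 1 0 2 i (by decide) (by decide) (by decide), flc 2 1, flfl]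
    have s2 : ∀ i, F (ee (fl 2 i) + ee (fl 0 (fl 1 (fl 2 (fl 2 i))))) =
        F (ee i + ee (fl 0 (fl 1 (fl 2 i)))) := by
      intro i
      rw [flc 1 2 i, flc 0 2, d3 2 0 1 i (by decide) (by decide) (by decide), flfl]
    have cov : ∀ i : ι3, i = (0,0,0) ∨ i = fl 0 (0,0,0) ∨ i = fl 1 (0,0,0) ∨ i = fl 2 (0,0,0) ∨
      i = fl 0 (fl 1 (0,0,0)) ∨ i = fl 0 (fl 2 (0,0,0)) ∨ i = fl 1 (fl 2 (0,0,0)) ∨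
      i = fl 0 (fl 1 (fl 2 (0,0,0))) := by decide
    have base : F (ee (0,0,0) + ee (fl 0 (fl 1 (fl 2 (0,0,0))))) = l := by
      rw [hl]; rfl
    intro i
    rcases cov i with rfl | rfl | rfl | rfl | rfl | rfl | rfl | rfl <;>
      simp only [s0, s1, s2, base]
  have cov : ∀ i j : ι3, j = i ∨ (∃ k, j = fl k i) ∨
      (∃ k m n, k ≠ m ∧ k ≠ n ∧ m ≠ n ∧ j = fl m (fl n i)) ∨ j = fl 0 (fl 1 (fl 2 i)) := by decide
  have q1 : ∀ i, Q2 (ee i) = 0 := by decide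
  have q2 : ∀ k i, Q2 (ee i + ee (fl k i)) = 0 := by decide
  have q3 : ∀ m n i, Q2 (ee i + ee (fl m (fl n i))) = 0 := by decide
  have q4 : ∀ i, Q2 (ee i + ee (fl 0 (fl 1 (fl 2 i)))) = 1 := by decide
  have := (h.add (Q2_quad.smul l)).zero (fun i => by simp [l0, q1]) (fun i j => by
    rcases cov i j with rfl | ⟨k, rfl⟩ | ⟨k, m, n, h1, h2, h3, rfl⟩ | rfl
    · simp [v2, h.1, Q2_quad.1]
    · simp [d1, q2]
    · simp [d2 k m n i h1 h2 h3, q3]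
    · simp [dn, q4, z2]) x
  have e2 : ∀ a b : ZMod 2, a + b = 0 → a = b := by decide
  exact e2 _ _ this

/-- `Q₂` is, up to equality of polynomial functions, the unique nonzero squarefree
polynomial of degree ≤ 2 (without constant term) invariant under the stabilizer of the
Segre variety. -/
theorem stmt15 :
    (∀ A : V8 ≃ₗ[ZMod 2] V8, A ∈ SegreStab → ∀ x, Q2 (A x) = Q2 x) ∧
    ∀ c : Finset ι3 → ZMod 2, c ∅ = 0 → (∀ s, c s ≠ 0 → s.card ≤ 2) → c ≠ 0 →
      (∀ A : V8 ≃ₗ[ZMod 2] V8, A ∈ SegreStab → ∀ x, mEval c (A x) = mEval c x) →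
      ∀ x, mEval c x = Q2 x := by
  refine ⟨part1, fun c h0 h2 hc hinv => ?_⟩
  obtain ⟨l, hl⟩ := uniq (mEval_quad c h0 h2) (fun k a x => hinv (TT k a) (TT_stab k a) x)
  have h01 : ∀ l : ZMod 2, l = 0 ∨ l = 1 := by decide
  rcases h01 l with rfl | rfl
  · exact absurd (mEval_zero c (fun x => by simp [hl])) hc
  · intro x; simp [hl]
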